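/- arXiv:2301.05441 — 5 statements merged into one kernel-verified Lean document; each statement's English description precedes it below -/
import Mathlib

section
/- Let φ: X → Y be a proximal extension of compact dynamics such that the almost periodic points are dense in X. Then (T,X) is an M-dynamic if and only if (T,Y) is an M-dynamic. -/
open scoped Topology

/-- A subset `A` of `T` is (right) syndetic: there is a compact `K ⊆ T` with
`Kt ∩ A ≠ ∅` for all `t ∈ T`. -/
def IsSyndetic {T : Type*} [Monoid T] [TopologicalSpace T] (A : Set T) : Prop :=
  ∃ K : Set T, IsCompact K ∧ ∀ t : T, ∃ k ∈ K, k * t ∈ A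

/-- `x` is an almost periodic point of the dynamic `(T,X)`. -/
def IsAPPoint (T : Type*) {X : Type*} [Monoid T] [TopologicalSpace T]
    [TopologicalSpace X] [MulAction T X] (x : X) : Prop :=
  ∀ U ∈ 𝓝 x, IsSyndetic {t : T | t • x ∈ U}

/-- The dynamic `(T,X)` is topologically transitive. -/
def IsTT (T X : Type*) [Monoid T] [TopologicalSpace X] [MulAction T X] : Prop :=
  ∀ U V : Set X, IsOpen U → IsOpen V → U.Nonempty → V.Nonempty →
    ∃ t : T, ∃ x ∈ U, t • x ∈ V

/-- The orbit closure of an almost periodic point is minimal: the point lies in every closed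
invariant set which meets its orbit closure. -/
lemma IsAPPoint.mem_of_mem_closure_orbit {T X : Type*} [Monoid T] [TopologicalSpace T]
    [TopologicalSpace X] [RegularSpace X] [MulAction T X] [ContinuousSMul T X]
    {x z : X} (hx : IsAPPoint T x) (hz : z ∈ closure (MulAction.orbit T x))
    {F : Set X} (hF : IsClosed F) (hinv : ∀ (t : T), ∀ w ∈ F, t • w ∈ F) (hzF : z ∈ F) :
    x ∈ F := by
  by_contra hxF
  obtain ⟨W, hW, hWc, hWF⟩ := exists_mem_nhds_isClosed_subset (hF.isOpen_compl.mem_nhds hxF)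
  obtain ⟨K, hK, hKW⟩ := hx W hW
  have : CompactSpace K := isCompact_iff_compactSpace.mp hK
  have hclosed : IsClosed {w : X | ∃ k ∈ K, k • w ∈ W} := by
    have himage : {w : X | ∃ k ∈ K, k • w ∈ W} =
        Prod.snd '' {p : K × X | (p.1 : T) • p.2 ∈ W} := by
      ext w
      simp
    rw [himage]
    exact isClosedMap_snd_of_compactSpace _ (hWc.preimage (by fun_prop))
  have hsub : MulAction.orbit T x ⊆ {w : X | ∃ k ∈ K, k • w ∈ W} := by
    rintro _ ⟨t, rfl⟩
    obtain ⟨k, hk, hkt⟩ := hKW t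
    exact ⟨k, hk, by simpa [mul_smul] using hkt⟩
  obtain ⟨k, -, hk⟩ := closure_minimal hsub hclosed hz
  exact hWF hk (hinv k z hzF)

/-- Continuous equivariant maps preserve almost periodic points. -/
lemma IsAPPoint.map {T X Y : Type*} [Monoid T] [TopologicalSpace T]
    [TopologicalSpace X] [TopologicalSpace Y] [MulAction T X] [MulAction T Y]
    {φ : X → Y} (hcont : Continuous φ) (hequiv : ∀ (t : T) (x : X), φ (t • x) = t • φ x)
    {x : X} (hx : IsAPPoint T x) : IsAPPoint T (φ x) := by
  intro U hU
  simpa [hequiv] using hx (φ ⁻¹' U) (hcont.continuousAt.preimage_mem_nhds hU)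

/-- Topological transitivity passes to factors. -/
lemma IsTT.map {T X Y : Type*} [Monoid T] [TopologicalSpace X] [TopologicalSpace Y]
    [MulAction T X] [MulAction T Y] {φ : X → Y} (hcont : Continuous φ)
    (hsurj : Function.Surjective φ) (hequiv : ∀ (t : T) (x : X), φ (t • x) = t • φ x)
    (h : IsTT T X) : IsTT T Y := by
  intro U V hU hV hUne hVne
  obtain ⟨t, x, hx, htx⟩ := h (φ ⁻¹' U) (φ ⁻¹' V) (hU.preimage hcont) (hV.preimage hcont)
    (hUne.preimage hsurj) (hVne.preimage hsurj)
  exact ⟨t, φ x, hx, by simpa [hequiv] using htx⟩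

/-- In a proximal extension with dense almost periodic points, no proper closed invariant
subset maps onto the factor. -/
lemma eq_univ_of_image_eq_univ_of_proximal {T X Y : Type*} [Monoid T] [TopologicalSpace T]
    [TopologicalSpace X] [RegularSpace X] [MulAction T X] [ContinuousSMul T X]
    {φ : X → Y}
    (hprox : ∀ x x' : X, φ x = φ x' →
        (closure (MulAction.orbit T (x, x')) ∩ Set.diagonal X).Nonempty)
    (hdense : Dense {x : X | IsAPPoint T x})
    {F : Set X} (hF : IsClosed F) (hinv : ∀ (t : T), ∀ w ∈ F, t • w ∈ F)
    (himage : φ '' F = Set.univ) : F = Set.univ := by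
  refine Set.eq_univ_of_univ_subset (hdense.closure_eq ▸ closure_minimal ?_ hF)
  intro x hx
  obtain ⟨f, hf, hfx⟩ : φ x ∈ φ '' F := himage ▸ Set.mem_univ _
  obtain ⟨⟨z, w⟩, hz, rfl : z = w⟩ := hprox f x hfx
  have hsub : MulAction.orbit T (f, x) ⊆ F ×ˢ closure (MulAction.orbit T x) := by
    rintro _ ⟨t, rfl⟩
    exact ⟨hinv t f hf, subset_closure ⟨t, rfl⟩⟩
  obtain ⟨hzF, hzx⟩ := closure_minimal hsub (hF.prod isClosed_closure) hz
  exact IsAPPoint.mem_of_mem_closure_orbit hx hzx hF hinv hzF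

/-- A closed invariant subset with nonempty interior of a topologically transitive dynamic
is the whole space. -/
lemma IsTT.eq_univ_of_isClosed {T X : Type*} [Monoid T] [TopologicalSpace X] [MulAction T X]
    (h : IsTT T X) {F U : Set X} (hF : IsClosed F) (hinv : ∀ (t : T), ∀ w ∈ F, t • w ∈ F)
    (hU : IsOpen U) (hUne : U.Nonempty) (hUF : U ⊆ F) : F = Set.univ := by
  by_contra hne
  obtain ⟨t, x, hx, htx⟩ := h U Fᶜ hU hF.isOpen_compl hUne (Set.nonempty_compl.mpr hne)
  exact htx (hinv t x (hUF hx))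

/-- Topological transitivity lifts through proximal extensions whose almost periodic points
are dense. -/
lemma IsTT.of_proximal {T X Y : Type*} [Monoid T] [TopologicalSpace T]
    [TopologicalSpace X] [CompactSpace X] [T2Space X] [TopologicalSpace Y] [T2Space Y]
    [MulAction T X] [ContinuousSMul T X] [MulAction T Y]
    {φ : X → Y} (hcont : Continuous φ) (hsurj : Function.Surjective φ)
    (hequiv : ∀ (t : T) (x : X), φ (t • x) = t • φ x)
    (hprox : ∀ x x' : X, φ x = φ x' →
        (closure (MulAction.orbit T (x, x')) ∩ Set.diagonal X).Nonempty)
    (hdense : Dense {x : X | IsAPPoint T x}) (hY : IsTT T Y) : IsTT T X := by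
  intro U V hU hV ⟨u, hu⟩ hVne
  set F : Set X := closure {w | ∃ t : T, ∃ x ∈ U, t • x = w}
  have hFclosed : IsClosed F := isClosed_closure
  have hFinv : ∀ (t : T), ∀ w ∈ F, t • w ∈ F := by
    intro t w hw
    refine map_mem_closure (continuous_const_smul t) hw ?_
    rintro _ ⟨s, x, hx, rfl⟩
    exact ⟨t * s, x, hx, mul_smul t s x⟩
  have himageinv : ∀ (t : T), ∀ y ∈ φ '' F, t • y ∈ φ '' F := by
    rintro t _ ⟨w, hw, rfl⟩
    exact ⟨t • w, hFinv t w hw, hequiv t w⟩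
  set A : Set X := ⋃ t : T, (t • ·) ⁻¹' U
  have hA : IsOpen A := isOpen_iUnion fun t => hU.preimage (continuous_const_smul t)
  have huA : u ∈ A := Set.mem_iUnion.mpr ⟨1, by simpa using hu⟩
  have hAF : A ⊆ F := by
    refine (hdense.open_subset_closure_inter hA).trans (closure_minimal ?_ hFclosed)
    rintro x ⟨hxA, hx⟩
    obtain ⟨t, ht⟩ := Set.mem_iUnion.mp hxA
    exact IsAPPoint.mem_of_mem_closure_orbit hx (subset_closure ⟨t, rfl⟩) hFclosed hFinv
      (subset_closure ⟨1, t • x, ht, one_smul T _⟩)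
  have hAcinv : ∀ (t : T), ∀ w ∈ Aᶜ, t • w ∈ Aᶜ := by
    intro t w hw htw
    obtain ⟨s, hs⟩ := Set.mem_iUnion.mp htw
    exact hw (Set.mem_iUnion.mpr ⟨s * t, by simpa [mul_smul] using hs⟩)
  have hAcne : φ '' Aᶜ ≠ Set.univ := fun h =>
    (eq_univ_of_image_eq_univ_of_proximal hprox hdense hA.isClosed_compl hAcinv h ▸
      Set.mem_univ u : u ∈ Aᶜ) huA
  have hsub : (φ '' Aᶜ)ᶜ ⊆ φ '' F := by
    intro y hy
    obtain ⟨x, rfl⟩ := hsurj y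
    exact ⟨x, hAF (by_contra fun hx => hy ⟨x, hx, rfl⟩), rfl⟩
  have hFuniv : F = Set.univ :=
    eq_univ_of_image_eq_univ_of_proximal hprox hdense hFclosed hFinv <|
      hY.eq_univ_of_isClosed (hcont.isClosedMap _ hFclosed) himageinv
        (hcont.isClosedMap _ hA.isClosed_compl).isOpen_compl
        (Set.nonempty_compl.mpr hAcne) hsub
  obtain ⟨v, hv⟩ := hVne
  obtain ⟨_, hwV, t, x, hx, rfl⟩ :=
    mem_closure_iff.mp (hFuniv ▸ Set.mem_univ v : v ∈ F) V hV hv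
  exact ⟨t, x, hx, hwV⟩

/-- Let `φ : X → Y` be a proximal extension of compact dynamics such that the almost
periodic points are dense in `X`.  Then `(T,X)` is an M-dynamic (topologically transitive
with dense almost periodic points) iff `(T,Y)` is. -/
theorem proximal_extension_M_dynamic_iff
    {T X Y : Type*} [Monoid T] [TopologicalSpace T]
    [TopologicalSpace X] [CompactSpace X] [T2Space X]
    [TopologicalSpace Y] [CompactSpace Y] [T2Space Y]
    [MulAction T X] [ContinuousSMul T X] [MulAction T Y] [ContinuousSMul T Y]
    (φ : X → Y) (hcont : Continuous φ) (hsurj : Function.Surjective φ)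
    (hequiv : ∀ (t : T) (x : X), φ (t • x) = t • φ x)
    (hprox : ∀ x x' : X, φ x = φ x' →
        (closure (MulAction.orbit T (x, x')) ∩ Set.diagonal X).Nonempty)
    (hdense : Dense {x : X | IsAPPoint T x}) :
    (IsTT T X ∧ Dense {x : X | IsAPPoint T x}) ↔
    (IsTT T Y ∧ Dense {y : Y | IsAPPoint T y}) := by
  refine ⟨fun ⟨hX, _⟩ => ⟨hX.map hcont hsurj hequiv, ?_⟩,
    fun ⟨hY, _⟩ => ⟨hY.of_proximal hcont hsurj hequiv hprox hdense, hdense⟩⟩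
  refine (hsurj.denseRange.dense_image hcont hdense).mono ?_
  rintro _ ⟨x, hx, rfl⟩
  exact IsAPPoint.map hcont hequiv hx
end

section
/- Every non-minimal M-dynamic is sensitive to initial conditions: if (T,X) is a topologically transitive dynamic whose almost periodic points are dense in X and which is not minimal, then there exists an entourage ε such that for every x ∈ X and every neighborhood U of x there exist y ∈ U and t ∈ T with (tx,ty) ∉ ε. -/
open scoped Uniformity Topology

/-- If `w` is not in the closure of `S`, then some symmetric entourage admits no chain of seven
steps from `w` to a point of `S`. -/
lemma exists_symm_entourage_no_chain {X : Type*} [UniformSpace X] {S : Set X} {w : X}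
    (hw : w ∉ closure S) :
    ∃ δ ∈ 𝓤 X, (∀ {a b : X}, (a, b) ∈ δ → (b, a) ∈ δ) ∧
      ∀ {a b c d e f r : X}, (w, a) ∈ δ → (a, b) ∈ δ → (b, c) ∈ δ → (c, d) ∈ δ → (d, e) ∈ δ →
        (e, f) ∈ δ → (f, r) ∈ δ → r ∉ S := by
  obtain ⟨ε, hε, hεS⟩ : ∃ ε ∈ 𝓤 X, ∀ r, (w, r) ∈ ε → r ∉ S := by
    have h : Sᶜ ∈ 𝓝 w := mem_interior_iff_mem_nhds.1 (by rwa [interior_compl])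
    obtain ⟨ε, hε, h⟩ := UniformSpace.mem_nhds_iff.1 h
    exact ⟨ε, hε, fun r hr => h hr⟩
  obtain ⟨ε₁, hε₁, -, h₁⟩ := comp_symm_of_uniformity hε
  obtain ⟨ε₂, hε₂, -, h₂⟩ := comp_symm_of_uniformity hε₁
  obtain ⟨δ, hδ, hsymm, h₃⟩ := comp_symm_of_uniformity hε₂
  refine ⟨δ, hδ, hsymm, fun {a b c d e f r} ha hb hc hd he hf hr => hεS r ?_⟩
  have two {u v y : X} (h : (u, v) ∈ δ) (h' : (v, y) ∈ δ) : (u, y) ∈ ε₂ := h₃ ⟨v, h, h'⟩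
  exact h₁ ⟨d, h₂ ⟨b, two ha hb, two hc hd⟩,
    h₂ ⟨f, two he hf, two hr (refl_mem_uniformity hδ)⟩⟩

/-- Points close enough to `z` stay close to the orbit of `z` along `s • k` for all `k` in a
compact set `K`. -/
lemma IsCompact.eventually_smul_near_orbit {T X : Type*} [Monoid T] [TopologicalSpace T]
    [UniformSpace X] [MulAction T X] [ContinuousSMul T X] {K : Set T} (hK : IsCompact K)
    (s : T) (z : X) {δ : Set (X × X)} (hδ : δ ∈ 𝓤 X) :
    ∀ᶠ v in 𝓝 z, ∀ k ∈ K, ∃ r ∈ MulAction.orbit T z, (s • k • v, r) ∈ δ := by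
  refine hK.eventually_forall_of_forall_eventually fun k _ => ?_
  have hcont : Continuous fun q : X × T => s • q.2 • q.1 := by fun_prop
  filter_upwards [hcont.continuousAt (mem_nhds_right (s • k • z) hδ)] with q hq
  exact ⟨s • k • z, ⟨s * k, mul_smul s k z⟩, hq⟩

/-- Every non-minimal M-dynamic is sensitive to initial conditions: if `(T,X)` is a
topologically transitive dynamic whose almost periodic points are dense in `X` and which
is not minimal, then there is an entourage `ε` such that every point has, arbitrarily
close to it, points whose orbits are `ε`-separated from its orbit. -/
theorem nonminimal_M_dynamic_sensitive
    {T X : Type*} [Monoid T] [TopologicalSpace T]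
    [UniformSpace X] [T2Space X] [MulAction T X] [ContinuousSMul T X]
    (hTT : ∀ U V : Set X, IsOpen U → IsOpen V → U.Nonempty → V.Nonempty →
        ∃ t : T, ∃ x ∈ U, t • x ∈ V)
    (hdense : Dense {x : X | ∀ U ∈ 𝓝 x, IsSyndetic {t : T | t • x ∈ U}})
    (hnonmin : ¬ ∀ x : X, Dense (MulAction.orbit T x)) :
    ∃ ε ∈ 𝓤 X, ∀ x : X, ∀ U ∈ 𝓝 x, ∃ y ∈ U, ∃ t : T, (t • x, t • y) ∉ ε := by
  simp only [not_forall, Dense] at hnonmin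
  obtain ⟨z, w, hw⟩ := hnonmin
  obtain ⟨δ, hδ, hsymm, hchain⟩ := exists_symm_entourage_no_chain hw
  refine ⟨δ, hδ, ?_⟩
  by_contra! hstable
  obtain ⟨x, U, hU, hstable⟩ := hstable
  have hUne : (interior U).Nonempty := ⟨x, mem_interior_iff_mem_nhds.2 hU⟩
  have hW : interior {a | (w, a) ∈ δ} ∈ 𝓝 w := interior_mem_nhds.2 (mem_nhds_left w hδ)
  obtain ⟨s, y₀, hy₀, hsy₀⟩ :=
    hTT _ _ isOpen_interior isOpen_interior hUne ⟨w, mem_of_mem_nhds hW⟩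
  have hwy₀ : (w, s • y₀) ∈ δ := interior_subset (s := {a | (w, a) ∈ δ}) hsy₀
  obtain ⟨p, hpU, hp⟩ := hdense.inter_open_nonempty _ isOpen_interior hUne
  obtain ⟨K, hK, hret⟩ :=
    hp _ ((continuous_const_smul s).continuousAt (mem_nhds_left (s • p) hδ))
  have hV := interior_mem_nhds.2 (hK.eventually_smul_near_orbit s z hδ)
  obtain ⟨t, y, hy, hty⟩ :=
    hTT _ _ isOpen_interior isOpen_interior hUne ⟨z, mem_of_mem_nhds hV⟩
  obtain ⟨k, hk, hkp⟩ := hret t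
  obtain ⟨r, hr, hyr⟩ := interior_subset hty k hk
  have hp' := hstable p (interior_subset hpU) (s * (k * t))
  have hy' := hstable y (interior_subset hy) (s * (k * t))
  have hkp' : (s • p, s • (k * t) • p) ∈ δ := hkp
  simp only [mul_smul] at hp' hy' hkp'
  exact hchain hwy₀ (hsymm (hstable y₀ (interior_subset hy₀) s))
    (hstable p (interior_subset hpU) s) hkp' (hsymm hp') hy' hyr hr
end

section
/- Let (T,X) be a semiflow on a Hausdorff uniform space with T such that ⋂_{s∈F} Ts ≠ ∅ for every finite subset F of T. Let x ∈ X be such that cl(Tx) is compact and the ω-limit set ω[x] is contained in the set of equicontinuity points of the semiflow. Then (T, ω[x]) is a minimal subsemiflow, every point of ω[x] is Birkhoff recurrent, and x is asymptotically almost periodic. -/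
open scoped Uniformity Topology

section AuxiliaryLemmas

open Set

/-- In a compact Hausdorff semigroup with continuous right translations, a homomorphic image of a
monoid whose principal left ideals have the finite intersection property, acting by continuous
left translations, has an idempotent in the intersection of the closures of its principal left
ideals. -/
theorem exists_idempotent_mem_iInter_closure {T M : Type*} [Monoid T] [Monoid M]
    [TopologicalSpace M] [CompactSpace M] [T2Space M]
    (hT : ∀ F : Finset T, ∃ g : T, ∀ s ∈ F, ∃ t : T, t * s = g)
    (f : T →* M) (hright : ∀ r : M, Continuous (· * r)) (hleft : ∀ t : T, Continuous (f t * ·)) :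
    ∃ u ∈ ⋂ s : T, closure (range fun t : T => f (t * s)), u * u = u := by
  refine exists_idempotent_in_compact_subsemigroup hright _ ?_
    (isClosed_iInter fun _ => isClosed_closure).isCompact ?_
  · refine CompactSpace.iInter_nonempty (fun _ => isClosed_closure) fun F => ?_
    obtain ⟨g, hg⟩ := hT F
    refine ⟨f g, mem_iInter₂.2 fun s hs => subset_closure ?_⟩
    obtain ⟨t, rfl⟩ := hg s hs
    exact ⟨t, rfl⟩
  · intro p hp q hq
    rw [mem_iInter] at hp hq ⊢
    intro s
    have hmul : ∀ t : T, f t * q ∈ closure (range fun t : T => f (t * s)) := fun t => by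
      refine map_mem_closure (hleft t) (hq s) ?_
      rintro _ ⟨r, rfl⟩
      exact ⟨t * r, by simp [mul_assoc]⟩
    refine isClosed_closure.closure_subset (map_mem_closure (f := (· * q)) (hright q) (hp 1) ?_)
    rintro _ ⟨t, rfl⟩
    simpa using hmul t

/-- The ω-limit set of a point of a semiflow. -/
def semiflowOmegaLimit (T : Type*) {X : Type*} [Monoid T] [TopologicalSpace X] [MulAction T X]
    (x : X) : Set X :=
  ⋂ s : T, closure (MulAction.orbit T (s • x))

section Topological

variable {T X : Type*} [Monoid T] [TopologicalSpace X] [MulAction T X]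

theorem isClosed_semiflowOmegaLimit (x : X) : IsClosed (semiflowOmegaLimit T x) :=
  isClosed_iInter fun _ => isClosed_closure

theorem semiflowOmegaLimit_subset (x : X) :
    semiflowOmegaLimit T x ⊆ closure (MulAction.orbit T x) := fun y hy => by
  simpa using mem_iInter.1 hy 1

theorem smul_mem_closure_orbit [ContinuousConstSMul T X] (t : T) {x y : X}
    (hy : y ∈ closure (MulAction.orbit T x)) : t • y ∈ closure (MulAction.orbit T x) :=
  map_mem_closure (continuous_const_smul t) hy fun _ hz => MulAction.mem_orbit_of_mem_orbit t hz

theorem smul_mem_semiflowOmegaLimit [ContinuousConstSMul T X] (t : T) {x y : X}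
    (hy : y ∈ semiflowOmegaLimit T x) : t • y ∈ semiflowOmegaLimit T x :=
  mem_iInter.2 fun s => smul_mem_closure_orbit t (mem_iInter.1 hy s)

/-- For every point with compact orbit closure there is a point of its ω-limit set that can be
approached simultaneously by common translates of both points. -/
theorem exists_mem_semiflowOmegaLimit_forall_nhds [T2Space X] [ContinuousConstSMul T X]
    (hT : ∀ F : Finset T, ∃ g : T, ∀ s ∈ F, ∃ t : T, t * s = g) {x : X}
    (hcpt : IsCompact (closure (MulAction.orbit T x))) :
    ∃ y ∈ semiflowOmegaLimit T x, ∀ U ∈ 𝓝 y, ∃ s : T, s • x ∈ U ∧ s • y ∈ U := by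
  set Y : Set X := closure (MulAction.orbit T x)
  have : CompactSpace Y := isCompact_iff_compactSpace.1 hcpt
  let _ : TopologicalSpace (Function.End Y) := inferInstanceAs (TopologicalSpace (Y → Y))
  have : CompactSpace (Function.End Y) := inferInstanceAs (CompactSpace (Y → Y))
  have : T2Space (Function.End Y) := inferInstanceAs (T2Space (Y → Y))
  have heval : ∀ z : Y, Continuous fun p : Function.End Y => p z := fun z => continuous_apply z
  have hval : ∀ z : Y, Continuous fun p : Function.End Y => (p z : X) := fun z =>
    continuous_subtype_val.comp (heval z)
  let f : T →* Function.End Y :=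
    { toFun := fun t z => ⟨t • (z : X), smul_mem_closure_orbit t z.2⟩
      map_one' := funext fun z => Subtype.ext (one_smul T (z : X))
      map_mul' := fun s t => funext fun z => Subtype.ext (mul_smul s t (z : X)) }
  obtain ⟨u, hu, huu⟩ := exists_idempotent_mem_iInter_closure hT f
    (fun r => continuous_pi fun z => heval (r z))
    (fun t => continuous_pi fun z =>
      ((hval z).const_smul t).subtype_mk _)
  rw [mem_iInter] at hu
  let x' : Y := ⟨x, subset_closure (MulAction.mem_orbit_self x)⟩
  refine ⟨u x', mem_iInter.2 fun s => ?_, fun U hU => ?_⟩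
  · refine map_mem_closure (f := fun p : Function.End Y => (p x' : X)) (hval x') (hu s) ?_
    rintro _ ⟨t, rfl⟩
    exact ⟨t, (mul_smul t s x).symm⟩
  · have hx : ∀ᶠ p : Function.End Y in 𝓝 u, (p x' : X) ∈ U :=
      (hval x').continuousAt hU
    have hy : ∀ᶠ p : Function.End Y in 𝓝 u, (p (u x') : X) ∈ U := by
      refine (hval (u x')).continuousAt ?_
      have h : u (u x') = u x' := congrFun huu x'
      simpa [h] using hU
    obtain ⟨_, ⟨hpx, hpy⟩, s, rfl⟩ := mem_closure_iff_nhds.1 (hu 1) _ (hx.and hy)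
    simp only [mul_one] at hpx hpy
    exact ⟨s, hpx, hpy⟩

end Topological

section Uniform

open scoped SetRel

variable {T X : Type*} [Monoid T] [UniformSpace X] [MulAction T X]

/-- An ω-limit set is the orbit closure of each of the equicontinuity points it contains. -/
theorem closure_orbit_eq_semiflowOmegaLimit [ContinuousConstSMul T X] {x y : X}
    (hy : y ∈ semiflowOmegaLimit T x)
    (hequi : ∀ ε ∈ 𝓤 X, ∃ U ∈ 𝓝 y, ∀ t : T, ∀ z ∈ U, (t • y, t • z) ∈ ε) :
    closure (MulAction.orbit T y) = semiflowOmegaLimit T x := by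
  refine subset_antisymm ((isClosed_semiflowOmegaLimit x).closure_subset_iff.2 ?_) fun z hz => ?_
  · rintro _ ⟨t, rfl⟩
    exact smul_mem_semiflowOmegaLimit t hy
  · rw [UniformSpace.mem_closure_iff_ball]
    intro ε hε
    obtain ⟨δ, hδ, hδsymm, hδε⟩ := comp_symm_mem_uniformity_sets hε
    obtain ⟨U, hU, hUδ⟩ := hequi δ hδ
    obtain ⟨_, hsU, s, rfl⟩ := mem_closure_iff_nhds.1 (semiflowOmegaLimit_subset x hy) U hU
    obtain ⟨_, htz, t, rfl⟩ := mem_closure_iff_nhds.1 (mem_iInter.1 hz s) _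
      (UniformSpace.ball_mem_nhds z hδ)
    exact ⟨t • y, hδε ⟨_, htz, hδsymm.symm _ _ (hUδ t _ hsU)⟩, t, rfl⟩

/-- On a compact set contained in the orbit closure of each of its points, finitely many
translations suffice to approximate every point from every other. -/
theorem exists_finite_forall_smul_mem [ContinuousConstSMul T X] {Y : Set X} (hY : IsCompact Y)
    (hmin : ∀ z ∈ Y, Y ⊆ closure (MulAction.orbit T z)) {ε : Set (X × X)} (hε : ε ∈ 𝓤 X) :
    ∃ K : Set T, K.Finite ∧ ∀ z ∈ Y, ∀ w ∈ Y, ∃ k ∈ K, (k • z, w) ∈ ε := by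
  obtain ⟨F, hF⟩ := (hY.prod hY).elim_finite_subcover
    (fun k : T => (fun p : X × X => (k • p.1, p.2)) ⁻¹' interior ε)
    (fun k => isOpen_interior.preimage ((continuous_fst.const_smul k).prodMk continuous_snd))
    (fun p hp => by
      obtain ⟨_, hk, k, rfl⟩ := mem_closure_iff_nhds.1 (hmin p.1 hp.1 hp.2) _
        (mem_nhds_right p.2 (interior_mem_uniformity hε))
      exact mem_iUnion.2 ⟨k, hk⟩)
  refine ⟨F, F.finite_toSet, fun z hz w hw => ?_⟩
  obtain ⟨k, hk, h⟩ := mem_iUnion₂.1 (hF (mk_mem_prod hz hw))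
  exact ⟨k, hk, interior_subset h⟩

end Uniform

end AuxiliaryLemmas

/-- Let `(T,X)` be a semiflow on a Hausdorff uniform space with `⋂_{s ∈ F} Ts ≠ ∅` for
every finite `F ⊆ T`.  Let `x` be such that `cl(Tx)` is compact and the ω-limit set
`ω[x] = ⋂_{s ∈ T} cl(Tsx)` consists of equicontinuity points.  Then `(T, ω[x])` is a
minimal subsemiflow, every point of `ω[x]` is Birkhoff recurrent, and `x` is
asymptotically almost periodic. -/
theorem omega_limit_equicontinuous_asymptotically_ap
    {T X : Type*} [Monoid T] [TopologicalSpace T]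
    [UniformSpace X] [T2Space X] [MulAction T X] [ContinuousSMul T X]
    (hT : ∀ F : Finset T, ∃ g : T, ∀ s ∈ F, ∃ t : T, t * s = g)
    (x : X)
    (hcpt : IsCompact (closure (MulAction.orbit T x)))
    (hequi : ∀ z ∈ ⋂ s : T, closure (MulAction.orbit T (s • x)),
        ∀ ε ∈ 𝓤 X, ∃ U ∈ 𝓝 z, ∀ t : T, ∀ y ∈ U, (t • z, t • y) ∈ ε) :
    (∀ y ∈ ⋂ s : T, closure (MulAction.orbit T (s • x)),
        closure (MulAction.orbit T y) = ⋂ s : T, closure (MulAction.orbit T (s • x))) ∧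
    (∀ y ∈ ⋂ s : T, closure (MulAction.orbit T (s • x)),
        ∀ ε ∈ 𝓤 X, ∃ K : Set T, IsCompact K ∧
          ∀ t t' : T, ∃ k ∈ K, (k • t • y, t' • y) ∈ ε) ∧
    (∃ y : X, IsAPPoint T y ∧
        ∀ ε ∈ 𝓤 X, ∃ s : T, ∀ t : T, (t • s • x, t • s • y) ∈ ε) := by
  have hmin : ∀ y ∈ semiflowOmegaLimit T x,
      closure (MulAction.orbit T y) = semiflowOmegaLimit T x := fun y hy =>
    closure_orbit_eq_semiflowOmegaLimit hy (hequi y hy)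
  have hrec : ∀ y ∈ semiflowOmegaLimit T x, ∀ ε ∈ 𝓤 X, ∃ K : Set T, IsCompact K ∧
      ∀ t t' : T, ∃ k ∈ K, (k • t • y, t' • y) ∈ ε := fun y hy ε hε => by
    obtain ⟨K, hK, h⟩ := exists_finite_forall_smul_mem
      (hcpt.of_isClosed_subset (isClosed_semiflowOmegaLimit x) (semiflowOmegaLimit_subset x))
      (fun z hz => (hmin z hz).ge) hε
    exact ⟨K, hK.isCompact, fun t t' =>
      h _ (smul_mem_semiflowOmegaLimit t hy) _ (smul_mem_semiflowOmegaLimit t' hy)⟩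
  refine ⟨hmin, hrec, ?_⟩
  obtain ⟨y, hy, hprox⟩ := exists_mem_semiflowOmegaLimit_forall_nhds hT hcpt
  refine ⟨y, fun U hU => ?_, fun ε hε => ?_⟩
  · obtain ⟨K, hK, h⟩ := hrec y hy _ (mem_nhds_uniformity_iff_left.1 hU)
    refine ⟨K, hK, fun t => ?_⟩
    obtain ⟨k, hk, hky⟩ := h t 1
    exact ⟨k, hk, by simpa [mul_smul] using hky⟩
  · obtain ⟨δ, hδ, hδsymm, hδε⟩ := comp_symm_mem_uniformity_sets hε
    obtain ⟨U, hU, hUδ⟩ := hequi y hy δ hδ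
    obtain ⟨s, hsx, hsy⟩ := hprox U hU
    exact ⟨s, fun t => hδε ⟨t • y, hδsymm.symm _ _ (hUδ t _ hsx), hUδ t _ hsy⟩⟩
end

section
/- Topological Fubini lemma: let φ: W → Z be a semi-open continuous surjection between Polish spaces and let K be a residual subset of W. Then the set Z_K = {z ∈ Z | K ∩ φ⁻¹(z) is a residual subset of the fiber φ⁻¹(z) in its subspace topology} is residual in Z. -/
open Set Filter Topology

/-- A map is semi-open if the image of every nonempty open set has nonempty interior. For a
continuous semi-open map, the image of an open set `B` lies in the closure of the interior of
the image of `B ∩ U` whenever `U` is dense and open. -/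
theorem image_subset_closure_interior_image_inter
    {W Z : Type*} [TopologicalSpace W] [TopologicalSpace Z] {φ : W → Z} (hcont : Continuous φ)
    (hsemi : ∀ U : Set W, IsOpen U → U.Nonempty → (interior (φ '' U)).Nonempty)
    {U B : Set W} (hU : IsOpen U) (hUd : Dense U) (hB : IsOpen B) :
    φ '' B ⊆ closure (interior (φ '' (B ∩ U))) := by
  rintro _ ⟨w, hw, rfl⟩
  rw [mem_closure_iff]
  intro O hO hwO
  have hBO : IsOpen (B ∩ φ ⁻¹' O) := hB.inter (hO.preimage hcont)
  obtain ⟨z, hz⟩ := hsemi _ (hBO.inter hU) (hUd.inter_open_nonempty _ hBO ⟨w, hw, hwO⟩)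
  have hsub : B ∩ φ ⁻¹' O ∩ U ⊆ B ∩ U := inter_subset_inter_left _ inter_subset_left
  obtain ⟨v, hv, rfl⟩ := interior_subset hz
  exact ⟨φ v, hv.1.2, interior_mono (image_mono hsub) hz⟩

/-- For a continuous semi-open map on a second countable space, a dense open set meets all
fibers over some residual set in a dense subset of the fiber. -/
theorem eventually_residual_dense_fiber
    {W Z : Type*} [TopologicalSpace W] [SecondCountableTopology W] [TopologicalSpace Z]
    {φ : W → Z} (hcont : Continuous φ)
    (hsemi : ∀ U : Set W, IsOpen U → U.Nonempty → (interior (φ '' U)).Nonempty)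
    {U : Set W} (hU : IsOpen U) (hUd : Dense U) :
    ∀ᶠ z in residual Z, Dense (Subtype.val ⁻¹' U : Set (φ ⁻¹' {z})) := by
  have hbasis := TopologicalSpace.isBasis_countableBasis W
  have h : ∀ᶠ z in residual Z, ∀ B ∈ TopologicalSpace.countableBasis W,
      z ∈ coborder (interior (φ '' (B ∩ U))) :=
    (eventually_countable_ball (TopologicalSpace.countable_countableBasis W)).2 fun B _ =>
      coborder_mem_residual isOpen_interior.isLocallyClosed
  filter_upwards [h] with z hz
  rw [dense_iff_inter_open]
  rintro _ ⟨O, hO, rfl⟩ ⟨⟨w, hw⟩, hwO⟩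
  obtain ⟨B, hB, hwB, hBO⟩ := hbasis.exists_subset_of_mem_open hwO hO
  have hzcl : z ∈ closure (interior (φ '' (B ∩ U))) :=
    image_subset_closure_interior_image_inter hcont hsemi hU hUd (hbasis.isOpen hB) ⟨w, hwB, hw⟩
  have hzint : z ∈ interior (φ '' (B ∩ U)) := by
    by_contra hn
    exact hz B hB ⟨hzcl, hn⟩
  obtain ⟨v, hv, hvz⟩ := interior_subset hzint
  exact ⟨⟨v, hvz⟩, hBO hv.1, hv.2⟩

/-- Topological `Fubini' lemma: if `φ : W → Z` is a semi-open continuous surjection of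
Polish spaces and `K` is a residual subset of `W`, then the set of `z ∈ Z` such that
`K ∩ φ⁻¹(z)` is a residual subset of the fiber `φ⁻¹(z)` (with its subspace topology) is
residual in `Z`. -/
theorem topological_fubini
    {W Z : Type*} [TopologicalSpace W] [PolishSpace W]
    [TopologicalSpace Z] [PolishSpace Z]
    (φ : W → Z) (hcont : Continuous φ) (hsurj : Function.Surjective φ)
    (hsemi : ∀ U : Set W, IsOpen U → U.Nonempty → (interior (φ '' U)).Nonempty)
    (K : Set W) (hK : K ∈ residual W) :
    {z : Z | (Subtype.val ⁻¹' K : Set (φ ⁻¹' {z})) ∈ residual (φ ⁻¹' {z})} ∈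
      residual Z := by
  obtain ⟨S, hSo, hSd, hSc, hSK⟩ := mem_residual_iff.1 hK
  have h : ∀ᶠ z in residual Z, ∀ U ∈ S, Dense (Subtype.val ⁻¹' U : Set (φ ⁻¹' {z})) :=
    (eventually_countable_ball hSc).2 fun U hU =>
      eventually_residual_dense_fiber hcont hsemi (hSo U hU) (hSd U hU)
  filter_upwards [h] with z hz
  have hmem : (⋂ U ∈ S, Subtype.val ⁻¹' U : Set (φ ⁻¹' {z})) ∈ residual (φ ⁻¹' {z}) :=
    (countable_bInter_mem hSc).2 fun U hU =>
      residual_of_dense_open ((hSo U hU).preimage continuous_subtype_val) (hz U hU)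
  refine mem_of_superset hmem fun x hx => hSK ?_
  simpa using hx
end

section
/- Let E be a nonempty Polish space and let R ⊆ E × E \ Δ_E be a symmetric relation on E with the property that there exists a residual subset A of E such that for each a ∈ A the section R[a] = {b ∈ E | (a,b) ∈ R} contains a residual subset of E. Then there is a dense uncountable subset B of E with B ⊆ A and B × B \ Δ_E ⊆ R. -/
/-- Transfinite recursion: a nonempty set of possible values, depending on the earlier values,
can be met simultaneously at all indices of a well-order. -/
theorem exists_forall_of_wellFoundedLT {ι α : Type*} [Preorder ι] [WellFoundedLT ι]
    (P : ∀ i : ι, (Set.Iio i → α) → α → Prop) (h : ∀ i s, ∃ y, P i s y) :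
    ∃ f : ι → α, ∀ i, P i (fun j ↦ f j) (f i) := by
  choose g hg using h
  let F : ∀ i : ι, (∀ j, j < i → α) → α := fun i s ↦ g i fun j ↦ s j j.2
  refine ⟨wellFounded_lt.fix F, fun i ↦ ?_⟩
  rw [wellFounded_lt.fix_eq F i]
  exact hg _ _

/-- If the sections of `R` over a residual set `A` are residual, there is a sequence of length
`ω₁` in `A` with increasingly related terms, each lying in a prescribed nonempty open set. -/
theorem exists_omega_one_pairwise_related {E : Type*} [TopologicalSpace E] [BaireSpace E]
    {R : Set (E × E)} {A : Set E} (hA : A ∈ residual E)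
    (hsec : ∀ a ∈ A, {b : E | (a, b) ∈ R} ∈ residual E)
    (U : (Cardinal.aleph.{0} 1).ord.ToType → Set E)
    (hU : ∀ i, IsOpen (U i)) (hne : ∀ i, (U i).Nonempty) :
    ∃ f : (Cardinal.aleph.{0} 1).ord.ToType → E,
      (∀ i, f i ∈ U i ∧ f i ∈ A) ∧ ∀ j i, j < i → (f j, f i) ∈ R := by
  obtain ⟨f, hf⟩ := exists_forall_of_wellFoundedLT
    (fun i (s : Set.Iio i → E) y ↦ y ∈ U i ∧ y ∈ A ∧ ∀ j, s j ∈ A → (s j, y) ∈ R) (by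
      intro i s
      have : Countable (Set.Iio i) := by
        rw [← Cardinal.mk_le_aleph0_iff, ← Cardinal.lt_aleph_one_iff]
        simpa using Cardinal.mk_Iio_lt i (by simp)
      have hres : ∀ᶠ y in residual E, y ∈ A ∧ ∀ j, s j ∈ A → (s j, y) ∈ R :=
        Filter.Eventually.and hA <| eventually_countable_forall.2 fun j ↦
          Filter.eventually_imp_distrib_left.2 (hsec (s j))
      exact (dense_of_mem_residual hres).inter_open_nonempty _ (hU i) (hne i))
  exact ⟨f, fun i ↦ ⟨(hf i).1, (hf i).2.1⟩, fun j i hji ↦ (hf i).2.2 ⟨j, hji⟩ (hf j).2.1⟩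

/-- Let `E` be a nonempty Polish space and `R ⊆ E × E \ Δ_E` a symmetric relation such
that for some residual set `A ⊆ E`, each section `R[a]` (`a ∈ A`) contains a residual
subset of `E`.  Then there is a dense uncountable set `B ⊆ A` with
`B × B \ Δ_E ⊆ R`. -/
theorem dense_uncountable_scrambled_set
    {E : Type*} [TopologicalSpace E] [PolishSpace E] [Nonempty E]
    (R : Set (E × E)) (hR : R ⊆ (Set.univ \ Set.diagonal E))
    (hsymm : ∀ a b : E, (a, b) ∈ R → (b, a) ∈ R)
    (A : Set E) (hA : A ∈ residual E)
    (hsec : ∀ a ∈ A, {b : E | (a, b) ∈ R} ∈ residual E) :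
    ∃ B : Set E, Dense B ∧ ¬ B.Countable ∧ B ⊆ A ∧
      ∀ x ∈ B, ∀ y ∈ B, x ≠ y → (x, y) ∈ R := by
  let ι := (Cardinal.aleph.{0} 1).ord.ToType
  have hι : Cardinal.aleph0 < Cardinal.mk ι := by simp [ι]
  have hinf : Infinite ι := Cardinal.infinite_iff.2 hι.le
  have hbasis := TopologicalSpace.isBasis_countableBasis E
  have hbne : (TopologicalSpace.countableBasis E).Nonempty :=
    let ⟨V, hV, _⟩ := hbasis.exists_subset_of_mem_open (Set.mem_univ (Classical.arbitrary E))
      isOpen_univ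
    ⟨V, hV⟩
  obtain ⟨u, hu⟩ := (TopologicalSpace.countable_countableBasis E).exists_eq_range hbne
  have hmem (n : ℕ) : u n ∈ TopologicalSpace.countableBasis E := hu ▸ Set.mem_range_self n
  let e : ι → ℕ := Function.invFun (Infinite.natEmbedding ι)
  have he : Function.Surjective e := Function.invFun_surjective (Infinite.natEmbedding ι).injective
  obtain ⟨f, hf, hfR⟩ := exists_omega_one_pairwise_related hA hsec (fun i ↦ u (e i))
    (fun i ↦ hbasis.isOpen (hmem _))
    (fun i ↦ TopologicalSpace.nonempty_of_mem_countableBasis (hmem _))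
  have hpair (i j : ι) (hij : i ≠ j) : (f i, f j) ∈ R :=
    hij.lt_or_gt.elim (hfR i j) fun h ↦ hsymm _ _ (hfR j i h)
  have hinj : Function.Injective f := fun i j hij ↦ by
    by_contra hne
    exact (hR (hpair i j hne)).2 hij
  refine ⟨Set.range f, hbasis.dense_iff.2 fun V hV _ ↦ ?_, fun hc ↦ ?_, ?_, ?_⟩
  · obtain ⟨n, rfl⟩ := hu ▸ hV
    obtain ⟨i, rfl⟩ := he n
    exact ⟨f i, (hf i).1, Set.mem_range_self i⟩
  · have := hc.to_subtype
    have : Countable ι := (Set.rangeFactorization_injective.2 hinj).countable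
    exact hι.not_ge Cardinal.mk_le_aleph0
  · rintro _ ⟨i, rfl⟩
    exact (hf i).2
  · rintro _ ⟨i, rfl⟩ _ ⟨j, rfl⟩ hij
    exact hpair i j (ne_of_apply_ne f hij)
end
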